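/- Suppose a = a(n) and m = m(n) are functions of n satisfying a → ∞, m/n → ∞, and a ≤ n³/m². Then, with probability tending to 1 as n → ∞, the uniformly random graph G_m on [n] with exactly m edges has the property that every vertex set of size q with 2 ≤ q ≤ a spans at most 3q edges. -/

import Mathlib

open Filter

attribute [local instance] Classical.propDecidable

/-- The edges of the complete graph on `Fin n`: non-diagonal unordered pairs. -/
abbrev CEdge (n : ℕ) : Type := {e : Sym2 (Fin n) // ¬ e.IsDiag}

/-- The sample space: a uniformly random ordering of the edges of `K_n`,
encoded as a bijection from positions to edges. -/
abbrev EdgeOrdering (n : ℕ) : Type := Fin (Fintype.card (CEdge n)) ≃ CEdge n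

/-- The uniform probability of an event on a finite sample space. -/
noncomputable def uprob {α : Type} [Fintype α] (P : α → Prop) : ℝ :=
  ((Finset.univ.filter P).card : ℝ) / (Fintype.card α : ℝ)

/-- The sample space of the uniformly random graph with exactly `m` edges on `Fin n`. -/
abbrev MGraph (n m : ℕ) : Type := {P : Finset (CEdge n) // P.card = m}

/-- The ratio of falling factorials is at most the corresponding power of the ratio. -/
lemma descFactorial_mul_pow_le {m N : ℕ} (h : m ≤ N) (k : ℕ) :
    m.descFactorial k * N ^ k ≤ N.descFactorial k * m ^ k := by
  induction k with
  | zero => simp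
  | succ k ih =>
    rw [Nat.descFactorial_succ, Nat.descFactorial_succ, pow_succ, pow_succ]
    have h1 : (m - k) * N ≤ (N - k) * m := by
      rw [Nat.sub_mul, Nat.sub_mul, mul_comm N m]
      exact Nat.sub_le_sub_left (Nat.mul_le_mul_left k h) _
    calc (m - k) * m.descFactorial k * (N ^ k * N)
        = (m - k) * N * (m.descFactorial k * N ^ k) := by ring
      _ ≤ (N - k) * m * (N.descFactorial k * m ^ k) := Nat.mul_le_mul h1 ih
      _ = _ := by ring

lemma choose_sub_mul_pow_le {m N k : ℕ} (hk : k ≤ m) (h : m ≤ N) :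
    (N - k).choose (m - k) * N ^ k ≤ N.choose m * m ^ k := by
  have h1 : m.choose k * N ^ k ≤ N.choose k * m ^ k := by
    have := descFactorial_mul_pow_le h k
    rw [Nat.descFactorial_eq_factorial_mul_choose, Nat.descFactorial_eq_factorial_mul_choose,
      mul_assoc, mul_assoc] at this
    exact Nat.le_of_mul_le_mul_left this (Nat.factorial_pos k)
  have h2 := Nat.choose_mul hk (n := N)
  refine Nat.le_of_mul_le_mul_left ?_ (Nat.choose_pos (hk.trans h))
  calc N.choose k * ((N - k).choose (m - k) * N ^ k)
      = N.choose k * (N - k).choose (m - k) * N ^ k := by ring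
    _ = N.choose m * (m.choose k * N ^ k) := by rw [← h2]; ring
    _ ≤ N.choose m * (N.choose k * m ^ k) := Nat.mul_le_mul_left _ h1
    _ = _ := by ring

lemma choose_mul_pow_le (M k : ℕ) : (M.choose k : ℝ) * (k : ℝ) ^ k ≤ (3 * M) ^ k := by
  have h1 : (M.choose k : ℝ) * k.factorial ≤ (M : ℝ) ^ k := by
    have := Nat.descFactorial_le_pow M k
    rw [Nat.descFactorial_eq_factorial_mul_choose, mul_comm] at this
    exact_mod_cast this
  have h2 : (k : ℝ) ^ k ≤ 3 ^ k * k.factorial := by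
    have h3 := Real.pow_div_factorial_le_exp (k : ℝ) (Nat.cast_nonneg k) k
    have h4 : Real.exp k ≤ 3 ^ k := by
      rw [← Real.exp_one_pow]
      exact pow_le_pow_left₀ (Real.exp_pos _).le Real.exp_one_lt_three.le k
    rw [div_le_iff₀ (by positivity)] at h3
    exact h3.trans (by gcongr)
  calc (M.choose k : ℝ) * (k : ℝ) ^ k ≤ M.choose k * (3 ^ k * k.factorial) := by gcongr
    _ = 3 ^ k * (M.choose k * k.factorial) := by ring
    _ ≤ 3 ^ k * (M : ℝ) ^ k := by gcongr
    _ = _ := by rw [mul_pow]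

section uprob

variable {α ι : Type} [Fintype α]

lemma uprob_eq (P : α → Prop) [DecidablePred P] :
    uprob P = ((Finset.univ.filter P).card : ℝ) / (Fintype.card α : ℝ) := by
  unfold uprob
  congr!

lemma uprob_mono {P Q : α → Prop} (h : ∀ x, P x → Q x) : uprob P ≤ uprob Q := by
  unfold uprob
  gcongr with x
  exact h x

lemma uprob_le_one (P : α → Prop) : uprob P ≤ 1 := by
  unfold uprob
  refine div_le_one_of_le₀ ?_ (by positivity)
  exact_mod_cast Finset.card_le_univ _

lemma uprob_add_uprob_not [Nonempty α] (P : α → Prop) :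
    uprob P + uprob (fun x => ¬ P x) = 1 := by
  unfold uprob
  rw [← add_div, ← Nat.cast_add, Finset.card_filter_add_card_filter_not, Finset.card_univ]
  exact div_self (by exact_mod_cast Fintype.card_ne_zero)

lemma uprob_exists_le (s : Finset ι) (P : ι → α → Prop) :
    uprob (fun x => ∃ i ∈ s, P i x) ≤ ∑ i ∈ s, uprob (P i) := by
  rw [uprob_eq]
  simp only [uprob_eq]
  rw [← Finset.sum_div]
  gcongr
  have h : Finset.univ.filter (fun x => ∃ i ∈ s, P i x)
      = s.biUnion (fun i => Finset.univ.filter (P i)) := by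
    ext x; simp
  rw [h]
  exact_mod_cast Finset.card_biUnion_le

end uprob

/-- A fixed set `S` lies in a uniformly random `m`-subset with probability at most
`(m / N) ^ |S|`. -/
lemma uprob_subset_le {α : Type} [Fintype α] {m : ℕ} (hm : m ≤ Fintype.card α)
    (S : Finset α) :
    uprob (fun G : {P : Finset α // P.card = m} => S ⊆ G.1)
      ≤ ((m : ℝ) / Fintype.card α) ^ S.card := by
  have hcard : Fintype.card {P : Finset α // P.card = m} = (Fintype.card α).choose m := by
    rw [← Fintype.card_finset_len]
  rw [uprob_eq, hcard]
  have hpos : (0 : ℝ) < (Fintype.card α).choose m := by exact_mod_cast Nat.choose_pos hm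
  by_cases hk : S.card ≤ m
  · have hc : (Finset.univ.filter (fun G : {P : Finset α // P.card = m} => S ⊆ G.1)).card
        ≤ (Fintype.card α - S.card).choose (m - S.card) := by
      rw [← Finset.card_compl, ← Finset.card_powersetCard]
      refine Finset.card_le_card_of_injOn (fun G => G.1 \ S) ?_ ?_
      · intro G hG
        have hG' : S ⊆ G.1 := by simpa using hG
        simp only [Finset.mem_coe, Finset.mem_powersetCard]
        refine ⟨fun x hx => ?_, ?_⟩
        · simp only [Finset.mem_compl]
          exact (Finset.mem_sdiff.mp hx).2
        · rw [Finset.card_sdiff_of_subset hG', G.2]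
      · intro G hG H hH h
        have hG' : S ⊆ G.1 := by simpa using hG
        have hH' : S ⊆ H.1 := by simpa using hH
        apply Subtype.ext
        rw [← Finset.sdiff_union_of_subset hG', ← Finset.sdiff_union_of_subset hH']
        exact congrArg (· ∪ S) h
    rcases Nat.eq_zero_or_pos (Fintype.card α) with h0 | h0
    · have hS : S.card = 0 := by have := Finset.card_le_univ S; omega
      rw [hS, pow_zero]
      rw [hS, Nat.sub_zero, Nat.sub_zero] at hc
      refine div_le_one_of_le₀ ?_ hpos.le
      exact_mod_cast hc
    · have hN : (0 : ℝ) < Fintype.card α := by exact_mod_cast h0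
      rw [div_pow, div_le_div_iff₀ hpos (by positivity), mul_comm ((m : ℝ) ^ S.card)]
      exact_mod_cast (Nat.mul_le_mul_right _ hc).trans (choose_sub_mul_pow_le hk hm)
  · have h0 : Finset.univ.filter (fun G : {P : Finset α // P.card = m} => S ⊆ G.1) = ∅ := by
      refine Finset.filter_eq_empty_iff.mpr fun G _ h => hk ?_
      rw [← G.2]
      exact Finset.card_le_card h
    rw [h0]
    simp only [Finset.card_empty, Nat.cast_zero, zero_div]
    positivity

/-- The edges of the complete graph spanned by `U`. -/
noncomputable def spannedEdges {n : ℕ} (U : Finset (Fin n)) : Finset (CEdge n) :=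
  Finset.univ.filter (fun e => ∀ v ∈ (e : Sym2 (Fin n)), v ∈ U)

lemma card_spannedEdges_le {n : ℕ} (U : Finset (Fin n)) :
    (spannedEdges U).card ≤ U.card ^ 2 := by
  have h1 : (spannedEdges U).card ≤ U.sym2.card := by
    refine Finset.card_le_card_of_injOn Subtype.val ?_ Subtype.val_injective.injOn
    intro e he
    rw [Finset.mem_coe, Finset.mem_sym2_iff]
    exact (Finset.mem_filter.mp he).2
  rw [Finset.card_sym2] at h1
  refine h1.trans ?_
  rw [Nat.choose_two_right, Nat.add_sub_cancel]
  apply Nat.div_le_of_le_mul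
  nlinarith [Nat.le_self_pow two_ne_zero U.card]

lemma card_cEdge (n : ℕ) : Fintype.card (CEdge n) = n.choose 2 := by
  have := Sym2.card_subtype_not_diag (α := Fin n)
  rw [Fintype.card_fin] at this
  rw [← this]

/-- First moment bound for the vertex sets of size `q` spanning at least `3 * q` edges. -/
lemma uprob_exists_dense_le {n m q : ℕ} (hm : m ≤ Fintype.card (CEdge n)) (hq : 0 < q) :
    uprob (fun G : MGraph n m => ∃ U ∈ Finset.powersetCard q (Finset.univ : Finset (Fin n)),
        ∃ S ∈ Finset.powersetCard (3 * q) (spannedEdges U), S ⊆ G.1)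
      ≤ (3 * n * q ^ 2 * ((m : ℝ) / Fintype.card (CEdge n)) ^ 3) ^ q := by
  set p : ℝ := (m : ℝ) / Fintype.card (CEdge n) with hp
  have hp0 : 0 ≤ p := by positivity
  have hq0 : (0 : ℝ) < q := by exact_mod_cast hq
  have hU : ∀ U ∈ Finset.powersetCard q (Finset.univ : Finset (Fin n)),
      uprob (fun G : MGraph n m => ∃ S ∈ Finset.powersetCard (3 * q) (spannedEdges U), S ⊆ G.1)
        ≤ (q : ℝ) ^ (3 * q) * p ^ (3 * q) := by
    intro U hU
    have hUq := (Finset.mem_powersetCard.mp hU).2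
    refine (uprob_exists_le _ _).trans ?_
    have h1 : ∀ S ∈ Finset.powersetCard (3 * q) (spannedEdges U),
        uprob (fun G : MGraph n m => S ⊆ G.1) ≤ p ^ (3 * q) := by
      intro S hS
      have := uprob_subset_le hm S
      rwa [(Finset.mem_powersetCard.mp hS).2] at this
    refine (Finset.sum_le_card_nsmul _ _ _ h1).trans ?_
    rw [nsmul_eq_mul, Finset.card_powersetCard]
    gcongr
    have h2 := choose_mul_pow_le (spannedEdges U).card (3 * q)
    have h3 : ((spannedEdges U).card : ℝ) ≤ (q : ℝ) ^ 2 := by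
      have := card_spannedEdges_le U
      rw [hUq] at this
      exact_mod_cast this
    have h4 : (3 * ((spannedEdges U).card : ℝ)) ^ (3 * q)
        ≤ (q : ℝ) ^ (3 * q) * ((3 * q : ℕ) : ℝ) ^ (3 * q) := by
      rw [← mul_pow]
      push_cast
      refine pow_le_pow_left₀ (by positivity) ?_ _
      nlinarith
    exact le_of_mul_le_mul_right (h2.trans h4) (by positivity)
  refine (uprob_exists_le _ _).trans ((Finset.sum_le_card_nsmul _ _ _ hU).trans ?_)
  rw [nsmul_eq_mul, Finset.card_powersetCard, Finset.card_univ, Fintype.card_fin]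
  have h5 := choose_mul_pow_le n q
  have h6 : (q : ℝ) ^ (3 * q) = (q : ℝ) ^ q * ((q : ℝ) ^ 2) ^ q := by
    rw [← mul_pow, pow_mul]; congr 1; ring
  calc (n.choose q : ℝ) * ((q : ℝ) ^ (3 * q) * p ^ (3 * q))
      = (n.choose q * (q : ℝ) ^ q) * (((q : ℝ) ^ 2) ^ q * p ^ (3 * q)) := by rw [h6]; ring
    _ ≤ (3 * n) ^ q * (((q : ℝ) ^ 2) ^ q * p ^ (3 * q)) := by gcongr
    _ = _ := by rw [pow_mul, ← mul_pow, ← mul_pow]; congr 1; ring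

/-- Quantitative form: the failure probability is at most `384 * n / m`. -/
lemma one_sub_le_uprob_sparse {n m a : ℕ} (hn : 16 ≤ n) (hm0 : 0 < m) (ha : 1 ≤ a)
    (ham : (a : ℝ) ≤ (n : ℝ) ^ 3 / (m : ℝ) ^ 2) (hx : 192 * ((n : ℝ) / m) ≤ 1 / 2) :
    1 - 384 * ((n : ℝ) / m) ≤ uprob (fun G : MGraph n m =>
      ∀ U : Finset (Fin n), 2 ≤ U.card → U.card ≤ a →
        (G.1.filter (fun e : CEdge n => ∀ v ∈ e.1, v ∈ U)).card ≤ 3 * U.card) := by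
  have hmR : (0 : ℝ) < m := by exact_mod_cast hm0
  have hnR : (16 : ℝ) ≤ n := by exact_mod_cast hn
  have hn0 : (0 : ℝ) < n := by linarith
  have haR : (1 : ℝ) ≤ a := by exact_mod_cast ha
  have ham' : (a : ℝ) * (m : ℝ) ^ 2 ≤ (n : ℝ) ^ 3 := (le_div_iff₀ (by positivity)).mp ham
  have hN : (n : ℝ) ^ 2 / 4 ≤ Fintype.card (CEdge n) := by
    rw [card_cEdge, Nat.cast_choose_two]
    nlinarith
  have hmN : m ≤ Fintype.card (CEdge n) := by
    have h1 : (m : ℝ) ^ 2 ≤ ((n : ℝ) ^ 2 / 4) ^ 2 := by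
      calc (m : ℝ) ^ 2 ≤ a * (m : ℝ) ^ 2 := le_mul_of_one_le_left (by positivity) haR
        _ ≤ (n : ℝ) ^ 3 := ham'
        _ ≤ ((n : ℝ) ^ 2 / 4) ^ 2 := by nlinarith [pow_pos hn0 3]
    have h2 := (pow_le_pow_iff_left₀ hmR.le (by positivity) two_ne_zero).mp h1
    exact_mod_cast h2.trans hN
  have hne : Nonempty (MGraph n m) := by
    obtain ⟨t, -, ht⟩ := Finset.exists_subset_card_eq
      (s := (Finset.univ : Finset (CEdge n))) (by simpa using hmN)
    exact ⟨⟨t, ht⟩⟩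
  set x : ℝ := 192 * ((n : ℝ) / m) with hxdef
  have hx0 : 0 ≤ x := by positivity
  set p : ℝ := (m : ℝ) / Fintype.card (CEdge n) with hp
  have hp0 : 0 ≤ p := by positivity
  have hple : p ≤ 4 * m / (n : ℝ) ^ 2 := by
    calc p ≤ m / ((n : ℝ) ^ 2 / 4) := by rw [hp]; gcongr
      _ = _ := by field_simp
  have hterm : ∀ q ∈ Finset.Icc 2 a,
      uprob (fun G : MGraph n m => ∃ U ∈ Finset.powersetCard q (Finset.univ : Finset (Fin n)),
        ∃ S ∈ Finset.powersetCard (3 * q) (spannedEdges U), S ⊆ G.1) ≤ x ^ q := by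
    intro q hq
    obtain ⟨hq2, hqa⟩ := Finset.mem_Icc.mp hq
    refine (uprob_exists_dense_le hmN (by omega)).trans ?_
    refine pow_le_pow_left₀ (by positivity) ?_ q
    have hqa' : (q : ℝ) ≤ a := by exact_mod_cast hqa
    have hsq : ((q : ℝ) * (m : ℝ) ^ 2) ^ 2 ≤ ((n : ℝ) ^ 3) ^ 2 := by
      gcongr
      exact (by gcongr : (q : ℝ) * (m : ℝ) ^ 2 ≤ a * (m : ℝ) ^ 2).trans ham'
    calc 3 * n * (q : ℝ) ^ 2 * p ^ 3
        ≤ 3 * n * (q : ℝ) ^ 2 * (4 * m / (n : ℝ) ^ 2) ^ 3 := by gcongr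
      _ = 192 * (((q : ℝ) * (m : ℝ) ^ 2) ^ 2 / ((n : ℝ) ^ 5 * m)) := by field_simp; ring
      _ ≤ 192 * (((n : ℝ) ^ 3) ^ 2 / ((n : ℝ) ^ 5 * m)) := by gcongr
      _ = x := by rw [hxdef]; field_simp
  have hsum : ∑ q ∈ Finset.Icc 2 a, x ^ q ≤ 2 * x := by
    have hlt : x < 1 := by linarith
    have hIcc : Finset.Icc 2 a ⊆ (Finset.range a).image (· + 1) := by
      intro q hq
      obtain ⟨h1, h2⟩ := Finset.mem_Icc.mp hq
      exact Finset.mem_image.mpr ⟨q - 1, Finset.mem_range.mpr (by omega), by omega⟩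
    calc ∑ q ∈ Finset.Icc 2 a, x ^ q
        ≤ ∑ q ∈ (Finset.range a).image (· + 1), x ^ q :=
          Finset.sum_le_sum_of_subset_of_nonneg hIcc fun _ _ _ => by positivity
      _ = (∑ q ∈ Finset.range a, x ^ q) * x := by
          rw [Finset.sum_image (fun _ _ _ _ h => Nat.succ_injective h), Finset.sum_mul]
          simp only [pow_succ]
      _ ≤ 2 * x := by
          gcongr
          have h1 := (summable_geometric_of_lt_one hx0 hlt).sum_le_tsum (Finset.range a)
            (fun _ _ => by positivity)
          rw [tsum_geometric_of_lt_one hx0 hlt] at h1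
          refine h1.trans ?_
          rw [inv_le_comm₀ (by linarith) (by norm_num)]
          linarith
  have hbad := (uprob_exists_le (Finset.Icc 2 a) (fun q (G : MGraph n m) =>
    ∃ U ∈ Finset.powersetCard q (Finset.univ : Finset (Fin n)),
      ∃ S ∈ Finset.powersetCard (3 * q) (spannedEdges U), S ⊆ G.1)).trans
    ((Finset.sum_le_sum hterm).trans hsum)
  rw [← uprob_add_uprob_not (fun G : MGraph n m =>
      ∀ U : Finset (Fin n), 2 ≤ U.card → U.card ≤ a →
        (G.1.filter (fun e : CEdge n => ∀ v ∈ e.1, v ∈ U)).card ≤ 3 * U.card)]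
  suffices h : uprob (fun G : MGraph n m => ¬ ∀ U : Finset (Fin n), 2 ≤ U.card → U.card ≤ a →
      (G.1.filter (fun e : CEdge n => ∀ v ∈ e.1, v ∈ U)).card ≤ 3 * U.card) ≤ 2 * x by
    linarith
  refine (uprob_mono fun G hG => ?_).trans hbad
  push Not at hG
  obtain ⟨U, h2, hUa, hlt⟩ := hG
  obtain ⟨S, hS, hScard⟩ := Finset.exists_subset_card_eq hlt.le
  refine ⟨U.card, Finset.mem_Icc.mpr ⟨h2, hUa⟩, U,
    Finset.mem_powersetCard.mpr ⟨Finset.subset_univ _, rfl⟩, S,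
    Finset.mem_powersetCard.mpr ⟨fun e he => ?_, hScard⟩,
    hS.trans (Finset.filter_subset _ _)⟩
  exact Finset.mem_filter.mpr ⟨Finset.mem_univ _, (Finset.mem_filter.mp (hS he)).2⟩


/-- Coercing a set of edges monadically to unordered pairs does not change edge counts. -/
lemma card_filter_coe_le {n : ℕ} (s : Finset (CEdge n)) (P : Sym2 (Fin n) → Prop)
    [DecidablePred P] [DecidablePred fun e : CEdge n => P e.1] :
    (Finset.filter P (do let e ← s; pure (e : Sym2 (Fin n)))).card
      ≤ (s.filter (fun e : CEdge n => P e.1)).card := by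
  have h : (do let e ← s; pure (e : Sym2 (Fin n))) = s.image Subtype.val := by
    ext e
    simp [Finset.bind_def, Finset.pure_def, eq_comm]
  rw [h, Finset.filter_image]
  refine Finset.card_image_le.trans (le_of_eq ?_)
  congr!

/-- If `a → ∞`, `m ≫ n` and `a ≤ n³/m²`, then with high probability every vertex set of
size `2 ≤ q ≤ a` in the uniformly random graph with `m` edges spans at most `3q` edges. -/
theorem stmt17 (a m : ℕ → ℕ)
    (ha : Tendsto (fun n => a n) atTop atTop)
    (hm : Tendsto (fun n : ℕ => (m n : ℝ) / (n : ℝ)) atTop atTop)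
    (ham : ∀ n : ℕ, (a n : ℝ) ≤ (n : ℝ) ^ 3 / (m n : ℝ) ^ 2) :
    Tendsto
      (fun n => uprob (fun G : MGraph n (m n) =>
        ∀ U : Finset (Fin n), 2 ≤ U.card → U.card ≤ a n →
          (G.1.filter (fun e => ∀ v ∈ (e : Sym2 (Fin n)), v ∈ U)).card ≤ 3 * U.card))
      atTop (nhds 1) := by
  have hinv : Tendsto (fun n : ℕ => (n : ℝ) / (m n : ℝ)) atTop (nhds 0) := by
    simpa only [Pi.inv_def, inv_div] using hm.inv_tendsto_atTop
  have hlow : Tendsto (fun n : ℕ => 1 - 384 * ((n : ℝ) / (m n : ℝ))) atTop (nhds 1) := by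
    simpa using (hinv.const_mul 384).const_sub 1
  refine tendsto_of_tendsto_of_tendsto_of_le_of_le' hlow tendsto_const_nhds ?_
    (Eventually.of_forall fun n => uprob_le_one _)
  filter_upwards [eventually_ge_atTop 16, ha.eventually_ge_atTop 1, hm.eventually_ge_atTop 384]
    with n hn han hmn
  have hn0 : (0 : ℝ) < n := by exact_mod_cast (by omega : 0 < n)
  have hm384 : 384 * (n : ℝ) ≤ m n := (le_div_iff₀ hn0).mp hmn
  have hm0 : (0 : ℝ) < m n := by linarith
  refine (one_sub_le_uprob_sparse hn (by exact_mod_cast hm0) han (ham n) ?_).trans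
    (uprob_mono fun G hG U h2 hU => (card_filter_coe_le G.1 _).trans (hG U h2 hU))
  rw [← mul_div_assoc, div_le_iff₀ hm0]
  linarith
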